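/- Let D_n = (N, A) be the complete digraph on n ≥ 4 nodes, c = (c_1,…,c_m) a cardinality sequence with m ≥ 2 and 2 ≤ c_1 < ⋯ < c_m ≤ n, and let W ⊆ N with 1 ∈ W and c_p < |W| < c_{p+1} for some p ∈ {1,…,m−1}. Then the cardinality forcing inequality (c_{p+1} − |W|)·Σ_{i∈W} x(δ^out(i)) − (|W| − c_p)·Σ_{i∈N∖W} x(δ^out(i)) ≤ c_p·(c_{p+1} − |W|) defines a facet of P* := {x ∈ P_C^c(D_n) : x(δ^out(1)) = 1} if and only if either (c_{p+1} − |W| ≥ 2 and c_{p+1} < n) or (c_{p+1} = n and |W| = n − 1). -/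

import Mathlib

open Finset

/-- A simple directed cycle in a digraph on the node set `Fin N`, encoded by its arc set:
there is an injective map `f` from the cyclically ordered index set `Fin (k+2)` (so the
cycle has length at least `2`) to the nodes, whose consecutive pairs are exactly the arcs
of `C`. -/
def IsSimpleCycle {N : ℕ} (C : Finset (Fin N × Fin N)) : Prop :=
  ∃ (k : ℕ) (f : Fin (k + 2) → Fin N), Function.Injective f ∧
    C = Finset.image (fun i : Fin (k + 2) => (f i, f (i + 1))) Finset.univ

/-- Incidence vector of an arc set. -/
noncomputable def incVec {N : ℕ} (C : Finset (Fin N × Fin N)) : Fin N → Fin N → ℝ :=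
  fun i j => if (i, j) ∈ C then 1 else 0

/-- The cardinality constrained cycle polytope `P_C^c(D_N)` of the complete digraph on
`Fin N`: the convex hull of the incidence vectors of simple directed cycles whose
cardinality is `c p` for some `p`. -/
noncomputable def cyclePolytope (N : ℕ) {m : ℕ} (c : Fin m → ℕ) :
    Set (Fin N → Fin N → ℝ) :=
  convexHull ℝ {x | ∃ C : Finset (Fin N × Fin N), IsSimpleCycle C ∧
    (∃ p, C.card = c p) ∧ x = incVec C}

/-- `x(δ^out(i))` in the complete digraph on `Fin N`. -/
noncomputable def outSum {N : ℕ} (x : Fin N → Fin N → ℝ) (i : Fin N) : ℝ :=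
  ∑ j ∈ Finset.univ.erase i, x i j

/-- The dimension (of the affine hull) of a subset of a real vector space. -/
noncomputable def adim {V : Type*} [AddCommGroup V] [Module ℝ V] (P : Set V) : ℕ :=
  Module.finrank ℝ (vectorSpan ℝ P)

/-- The valid inequality `f x ≤ b` defines a facet of `P`: it is valid and its face has
dimension `(dim P) - 1`. -/
def IsFacetLE {V : Type*} [AddCommGroup V] [Module ℝ V] (P : Set V) (f : V → ℝ) (b : ℝ) :
    Prop :=
  (∀ x ∈ P, f x ≤ b) ∧ adim {x ∈ P | f x = b} + 1 = adim P

section FacetCriteria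

variable {E : Type*} [AddCommGroup E] [Module ℝ E]

lemma LinearMap.eq_zero_of_mem_vectorSpan {F : Set E} {φ : E →ₗ[ℝ] ℝ}
    (h : ∀ x ∈ F, ∀ y ∈ F, φ x = φ y) {u : E} (hu : u ∈ vectorSpan ℝ F) : φ u = 0 := by
  have hle : vectorSpan ℝ F ≤ LinearMap.ker φ := by
    rw [vectorSpan_def, Submodule.span_le]
    rintro _ ⟨x, hx, y, hy, rfl⟩
    simp [h x hx y hy]
  exact hle hu

/-- A proper face on which every constant functional is, on all of `P`, an affine function of
the defining functional has codimension one. -/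
lemma adim_add_one_eq_of_forall_dual [FiniteDimensional ℝ E] {F P : Set E} (hFP : F ⊆ P)
    (f : E →ₗ[ℝ] ℝ) (b : ℝ) (hf : ∀ x ∈ F, f x = b) {x₀ x₁ : E} (hx₀ : x₀ ∈ F)
    (hx₁ : x₁ ∈ P) (hne : f x₁ ≠ b)
    (hdual : ∀ φ : E →ₗ[ℝ] ℝ, (∀ x ∈ F, ∀ y ∈ F, φ x = φ y) →
      ∃ μ ν : ℝ, ∀ x ∈ P, φ x = μ * f x + ν) :
    adim F + 1 = adim P := by
  have hv : x₁ - x₀ ∉ vectorSpan ℝ F := fun h => hne <| by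
    have := LinearMap.eq_zero_of_mem_vectorSpan
      (fun x hx y hy => (hf x hx).trans (hf y hy).symm) h
    rw [map_sub, hf x₀ hx₀] at this
    linarith
  have hVP : vectorSpan ℝ F ⊔ Submodule.span ℝ {x₁ - x₀} = vectorSpan ℝ P := by
    apply le_antisymm
    · refine sup_le (vectorSpan_mono ℝ hFP) ?_
      rw [Submodule.span_singleton_le_iff_mem]
      exact vsub_mem_vectorSpan ℝ hx₁ (hFP hx₀)
    · intro w hw
      by_contra hcon
      obtain ⟨φ, hφw, hφ⟩ := Submodule.exists_le_ker_of_notMem hcon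
      have hφF : ∀ u ∈ vectorSpan ℝ F, φ u = 0 := fun u hu =>
        hφ (Submodule.mem_sup_left hu)
      have hφv : φ (x₁ - x₀) = 0 :=
        hφ (Submodule.mem_sup_right (Submodule.mem_span_singleton_self _))
      obtain ⟨μ, ν, hμ⟩ := hdual φ fun x hx y hy => by
        have := hφF _ (vsub_mem_vectorSpan ℝ hx hy)
        rw [vsub_eq_sub, map_sub] at this
        linarith
      have hμ0 : μ = 0 := by
        rw [map_sub, hμ _ hx₁, hμ _ (hFP hx₀), hf _ hx₀] at hφv
        have : μ * (f x₁ - b) = 0 := by linarith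
        exact (mul_eq_zero.mp this).resolve_right (sub_ne_zero.mpr hne)
      refine hφw (LinearMap.eq_zero_of_mem_vectorSpan (fun x hx y hy => ?_) hw)
      rw [hμ x hx, hμ y hy, hμ0]
      ring
  rw [adim, adim, ← hVP, Submodule.finrank_sup_span_singleton hv]

/-- A face contained in the intersection of two hyperplanes that are independent on `P` has
codimension at least two. -/
lemma adim_add_two_le [FiniteDimensional ℝ E] {F P : Set E} (hFP : F ⊆ P)
    (f g : E →ₗ[ℝ] ℝ) (b d : ℝ) (hf : ∀ x ∈ F, f x = b) (hg : ∀ x ∈ F, g x = d)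
    {x₀ x₁ x₂ : E} (hx₀ : x₀ ∈ F) (hx₁ : x₁ ∈ P) (hx₂ : x₂ ∈ P) (hne : f x₁ ≠ b)
    (hdet : (f x₁ - b) * (g x₂ - d) ≠ (f x₂ - b) * (g x₁ - d)) :
    adim F + 2 ≤ adim P := by
  have hf0 : ∀ u ∈ vectorSpan ℝ F, f u = 0 := fun u hu =>
    LinearMap.eq_zero_of_mem_vectorSpan (fun x hx y hy => (hf x hx).trans (hf y hy).symm) hu
  have hg0 : ∀ u ∈ vectorSpan ℝ F, g u = 0 := fun u hu =>
    LinearMap.eq_zero_of_mem_vectorSpan (fun x hx y hy => (hg x hx).trans (hg y hy).symm) hu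
  have hv₁ : x₁ - x₀ ∉ vectorSpan ℝ F := fun h => hne <| by
    have := hf0 _ h
    rw [map_sub, hf x₀ hx₀] at this
    linarith
  have hv₂ : x₂ - x₀ ∉ vectorSpan ℝ F ⊔ Submodule.span ℝ {x₁ - x₀} := fun h => hdet <| by
    obtain ⟨u, hu, w, hw, huw⟩ := Submodule.mem_sup.mp h
    obtain ⟨t, rfl⟩ := Submodule.mem_span_singleton.mp hw
    have h1 := congrArg f huw
    have h2 := congrArg g huw
    simp only [map_add, map_smul, map_sub, hf0 u hu, hg0 u hu, hf x₀ hx₀, hg x₀ hx₀,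
      smul_eq_mul, zero_add] at h1 h2
    rw [← h1, ← h2]
    ring
  have hle : vectorSpan ℝ F ⊔ Submodule.span ℝ {x₁ - x₀} ⊔ Submodule.span ℝ {x₂ - x₀} ≤
      vectorSpan ℝ P := by
    simp only [sup_le_iff, Submodule.span_singleton_le_iff_mem]
    exact ⟨⟨vectorSpan_mono ℝ hFP, vsub_mem_vectorSpan ℝ hx₁ (hFP hx₀)⟩,
      vsub_mem_vectorSpan ℝ hx₂ (hFP hx₀)⟩
  have := Submodule.finrank_mono hle
  rw [Submodule.finrank_sup_span_singleton hv₂,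
    Submodule.finrank_sup_span_singleton hv₁] at this
  exact this

end FacetCriteria

section CycleVectors

variable {n : ℕ}

/-- The arcs of the closed walk visiting `f 0, f 1, …` in cyclic order. -/
def cycleArcs {k : ℕ} (f : Fin (k + 2) → Fin n) : Finset (Fin n × Fin n) :=
  Finset.image (fun i => (f i, f (i + 1))) Finset.univ

lemma mem_cycleArcs {k : ℕ} {f : Fin (k + 2) → Fin n} (hf : Function.Injective f)
    (x : Fin (k + 2)) (j : Fin n) : (f x, j) ∈ cycleArcs f ↔ f (x + 1) = j := by
  simp only [cycleArcs, mem_image, mem_univ, true_and, Prod.mk.injEq]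
  constructor
  · rintro ⟨y, hy, rfl⟩
    rw [hf hy]
  · rintro rfl
    exact ⟨x, rfl, rfl⟩

lemma mem_image_of_mem_cycleArcs {k : ℕ} {f : Fin (k + 2) → Fin n} {i j : Fin n}
    (h : (i, j) ∈ cycleArcs f) : i ∈ univ.image f ∧ j ∈ univ.image f := by
  simp only [cycleArcs, mem_image, mem_univ, true_and, Prod.mk.injEq] at h ⊢
  obtain ⟨x, hi, hj⟩ := h
  exact ⟨⟨x, hi⟩, ⟨x + 1, hj⟩⟩

lemma cycleArcs_injective {k : ℕ} {f : Fin (k + 2) → Fin n} (hf : Function.Injective f) :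
    Function.Injective fun i => (f i, f (i + 1)) :=
  fun _ _ h => hf (congrArg Prod.fst h)

lemma card_cycleArcs {k : ℕ} {f : Fin (k + 2) → Fin n} (hf : Function.Injective f) :
    (cycleArcs f).card = (univ.image f).card := by
  rw [cycleArcs, card_image_of_injective _ (cycleArcs_injective hf),
    card_image_of_injective _ hf]

lemma outSum_incVec_cycleArcs {k : ℕ} {f : Fin (k + 2) → Fin n} (hf : Function.Injective f)
    (i : Fin n) :
    outSum (incVec (cycleArcs f)) i = if i ∈ univ.image f then 1 else 0 := by
  split_ifs with hi
  · obtain ⟨x, -, rfl⟩ := mem_image.mp hi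
    have hx : f (x + 1) ∈ univ.erase (f x) := by
      simp [hf.eq_iff]
    simp only [outSum, incVec, mem_cycleArcs hf]
    rw [sum_ite_eq, if_pos hx]
  · refine sum_eq_zero fun j _ => ?_
    rw [incVec, if_neg fun h => hi (mem_image_of_mem_cycleArcs h).1]

/-- The coefficient of a linear functional at the arc `(i, j)`. -/
def arcCoeff (φ : (Fin n → Fin n → ℝ) →ₗ[ℝ] ℝ) (i j : Fin n) : ℝ :=
  φ (Pi.single i (Pi.single j 1))

lemma incVec_eq_sum (C : Finset (Fin n × Fin n)) :
    incVec C = ∑ a ∈ C, Pi.single a.1 (Pi.single a.2 (1 : ℝ)) := by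
  ext i j
  simp only [incVec, Finset.sum_apply]
  have h : ∀ a : Fin n × Fin n,
      (Pi.single a.1 (Pi.single a.2 (1 : ℝ)) : Fin n → Fin n → ℝ) i j =
        if (i, j) = a then 1 else 0 := by
    rintro ⟨u, v⟩
    by_cases hu : i = u <;> by_cases hv : j = v <;> simp [hu, hv]
  simp only [h, sum_ite_eq]

lemma map_incVec_cycleArcs {k : ℕ} {f : Fin (k + 2) → Fin n} (hf : Function.Injective f)
    (φ : (Fin n → Fin n → ℝ) →ₗ[ℝ] ℝ) :
    φ (incVec (cycleArcs f)) = ∑ x, arcCoeff φ (f x) (f (x + 1)) := by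
  rw [incVec_eq_sum, map_sum, cycleArcs, sum_image (cycleArcs_injective hf).injOn]
  rfl

/-- A functional with coefficients `α i + β j` evaluates on a cycle to the sum of the node
weights `α i + β i`. -/
lemma map_incVec_cycleArcs_of_separable {k : ℕ} {f : Fin (k + 2) → Fin n}
    (hf : Function.Injective f) (φ : (Fin n → Fin n → ℝ) →ₗ[ℝ] ℝ) (α β : Fin n → ℝ)
    (hφ : ∀ i j, i ≠ j → arcCoeff φ i j = α i + β j) :
    φ (incVec (cycleArcs f)) = ∑ i ∈ univ.image f, (α i + β i) := by
  rw [map_incVec_cycleArcs hf, sum_image hf.injOn, sum_add_distrib,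
    ← Equiv.sum_comp (Equiv.addRight (1 : Fin (k + 2))) fun x => β (f x), ← sum_add_distrib]
  refine sum_congr rfl fun x _ => hφ _ _ (hf.ne ?_)
  simp

lemma exists_cycle (V : Finset (Fin n)) (hV : 2 ≤ V.card) :
    ∃ (k : ℕ) (f : Fin (k + 2) → Fin n), Function.Injective f ∧ univ.image f = V := by
  obtain ⟨k, hk⟩ := Nat.exists_eq_add_of_le' hV
  refine ⟨k, V.orderEmbOfFin hk, (V.orderEmbOfFin hk).injective, ?_⟩
  simp

lemma exists_cycle_with_start {S : Finset (Fin n)} {i j l t : Fin n} (hij : i ≠ j)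
    (hil : i ≠ l) (hit : i ≠ t) (hjl : j ≠ l) (hjt : j ≠ t) (hlt : l ≠ t)
    (hi : i ∈ S) (hj : j ∈ S) (hl : l ∈ S) (ht : t ∈ S) :
    ∃ (r : ℕ) (f : Fin (r + 4) → Fin n), Function.Injective f ∧ univ.image f = S ∧
      f 0 = i ∧ f 1 = j ∧ f 2 = l ∧ f 3 = t := by
  set e := (S \ {i, j, l, t}).orderEmbOfFin rfl with he
  have hmem : ∀ x, e x ∈ S \ {i, j, l, t} := fun x => orderEmbOfFin_mem _ _ x
  have hne : ∀ x, e x ≠ i ∧ e x ≠ j ∧ e x ≠ l ∧ e x ≠ t := fun x => by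
    simpa using (mem_sdiff.mp (hmem x)).2
  have himg : univ.image e = S \ {i, j, l, t} := by simp [he]
  refine ⟨_, Fin.cons i (Fin.cons j (Fin.cons l (Fin.cons t e))), ?_, ?_, rfl, rfl, rfl, rfl⟩
  · simp only [Fin.cons_injective_iff, Fin.range_cons, Set.mem_insert_iff, Set.mem_range,
      not_or, not_exists]
    exact ⟨⟨hij, hil, hit, fun x => (hne x).1⟩, ⟨hjl, hjt, fun x => (hne x).2.1⟩,
      ⟨hlt, fun x => (hne x).2.2.1⟩, fun x => (hne x).2.2.2, e.injective⟩
  · have hsub : ({i, j, l, t} : Finset (Fin n)) ⊆ S := by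
      simp [insert_subset_iff, hi, hj, hl, ht]
    refine Eq.trans ?_ ((congrArg _ himg).trans (union_sdiff_of_subset hsub))
    ext x
    simp only [mem_image, mem_univ, true_and, Fin.exists_fin_succ, Fin.cons_zero,
      Fin.cons_succ, mem_union, mem_insert, mem_singleton]
    grind

/-- Exchanging the second and third node of a cycle. -/
lemma sum_cycle_exchange {r : ℕ} (f : Fin (r + 4) → Fin n) (g : Fin n → Fin n → ℝ) :
    ∑ x, g (f x) (f (x + 1)) -
      ∑ x, g (f (Equiv.swap 1 2 x)) (f (Equiv.swap 1 2 (x + 1))) =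
    g (f 0) (f 1) + g (f 1) (f 2) + g (f 2) (f 3)
      - (g (f 0) (f 2) + g (f 2) (f 1) + g (f 1) (f 3)) := by
  have v1 : ((1 : Fin (r + 4)) : ℕ) = 1 := Nat.mod_eq_of_lt (by lia)
  have v2 : ((2 : Fin (r + 4)) : ℕ) = 2 := Nat.mod_eq_of_lt (by lia)
  have v3 : ((3 : Fin (r + 4)) : ℕ) = 3 := Nat.mod_eq_of_lt (by lia)
  have hfix : ∀ x : Fin (r + 4), (x : ℕ) ≠ 1 → (x : ℕ) ≠ 2 → Equiv.swap 1 2 x = x :=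
    fun x h1 h2 => Equiv.swap_apply_of_ne_of_ne (fun h => h1 (h ▸ v1)) (fun h => h2 (h ▸ v2))
  have htail : ∀ x : Fin (r + 1), Equiv.swap (1 : Fin (r + 4)) 2 x.succ.succ.succ =
      x.succ.succ.succ := fun x => hfix _ (by simp) (by simp)
  have htail' : ∀ x : Fin (r + 1), Equiv.swap (1 : Fin (r + 4)) 2 (x.succ.succ.succ + 1) =
      x.succ.succ.succ + 1 := fun x => by
    refine hfix _ ?_ ?_ <;>
    · rw [Fin.val_add_one]
      split_ifs <;> simp
  have h0 : Equiv.swap (1 : Fin (r + 4)) 2 0 = 0 := hfix _ (by simp) (by simp)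
  have h3 : Equiv.swap (1 : Fin (r + 4)) 2 3 = 3 := hfix _ (by lia) (by lia)
  have e1 : (0 : Fin (r + 3)).succ = (1 : Fin (r + 4)) := rfl
  have e2 : (0 : Fin (r + 2)).succ.succ = (2 : Fin (r + 4)) := rfl
  have e3 : (1 : Fin (r + 4)) + 1 = 2 := rfl
  have e4 : (2 : Fin (r + 4)) + 1 = 3 := rfl
  simp only [Fin.sum_univ_succ (n := r + 3), Fin.sum_univ_succ (n := r + 2),
    Fin.sum_univ_succ (n := r + 1), htail, htail', e1, e2, e3, e4, h0, h3, zero_add,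
    Equiv.swap_apply_left, Equiv.swap_apply_right]
  ring

end CycleVectors

section Separable

variable {n : ℕ}

/-- If all cycles on the node set `S` have the same value, exchanging two consecutive nodes of
a path in `S` does not change its value. -/
lemma arcCoeff_exchange (φ : (Fin n → Fin n → ℝ) →ₗ[ℝ] ℝ) (γ : ℝ) {S : Finset (Fin n)}
    (hφ : ∀ (k : ℕ) (f : Fin (k + 2) → Fin n), Function.Injective f → univ.image f = S →
      φ (incVec (cycleArcs f)) = γ)
    {i j l t : Fin n} (hij : i ≠ j) (hil : i ≠ l) (hit : i ≠ t) (hjl : j ≠ l) (hjt : j ≠ t)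
    (hlt : l ≠ t) (hS : {i, j, l, t} ⊆ S) :
    arcCoeff φ i j + arcCoeff φ j l + arcCoeff φ l t =
      arcCoeff φ i l + arcCoeff φ l j + arcCoeff φ j t := by
  simp only [insert_subset_iff, singleton_subset_iff] at hS
  obtain ⟨r, f, hf, himg, rfl, rfl, rfl, rfl⟩ :=
    exists_cycle_with_start hij hil hit hjl hjt hlt hS.1 hS.2.1 hS.2.2.1 hS.2.2.2
  have hf' : Function.Injective (f ∘ Equiv.swap 1 2) := hf.comp (Equiv.injective _)
  have himg' : univ.image (f ∘ Equiv.swap 1 2) = S := by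
    rw [← image_image, image_univ_equiv, himg]
  have h1 := hφ (r + 2) f hf himg
  have h2 := hφ (r + 2) _ hf' himg'
  rw [map_incVec_cycleArcs hf] at h1
  rw [map_incVec_cycleArcs hf'] at h2
  have h3 := sum_cycle_exchange f (arcCoeff φ)
  simp only [Function.comp_apply] at h2
  linarith

lemma exists_separation_of_exchange (g : Fin n → Fin n → ℝ) {a b d e : Fin n} (hab : a ≠ b)
    (had : a ≠ d) (hbd : b ≠ d) (hae : a ≠ e) (hbe : b ≠ e) (hde : d ≠ e)
    (hg : ∀ i j l t, i ≠ j → i ≠ l → i ≠ t → j ≠ l → j ≠ t → l ≠ t →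
      {a, b} ⊆ ({i, j, l, t} : Finset (Fin n)) →
      g i j + g j l + g l t = g i l + g l j + g j t) :
    ∃ α β : Fin n → ℝ, ∀ i j, i ≠ j → g i j = α i + β j := by
  have hX : ∀ i j l t, i ≠ j → i ≠ l → i ≠ t → j ≠ l → j ≠ t → l ≠ t →
      {a, b} ⊆ ({i, j, l, t} : Finset (Fin n)) → g i l + g j t = g i t + g j l := by
    intro i j l t hij hil hit hjl hjt hlt hmem
    have h1 := hg i j l t hij hil hit hjl hjt hlt hmem
    have h2 := hg i j t l hij hit hil hjt hjl hlt.symm (by grind)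
    have h3 := hg i l t j hil hit hij hlt hjl.symm hjt.symm (by grind)
    linarith
  have hH : ∀ t i, t ≠ a → t ≠ b → i ≠ a → i ≠ b → i ≠ t →
      g i a + g a b + g b i = g i b + g b a + g a i := by
    intro t i hta htb hia hib hit
    have h1 := hg i a b t hia hib hit hab hta.symm htb.symm (by grind)
    have h2 := hX a b i t hab hia.symm hta.symm hib.symm htb.symm hit (by grind)
    linarith
  refine ⟨fun i => if i = a then 0 else if i = b then g b d - g a d else g i b - g a b,
    fun j => if j = a then g b a - (g b d - g a d) else g a j, fun i j hij => ?_⟩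
  by_cases hia : i = a
  · subst hia
    simp [hij.symm]
  by_cases hja : j = a
  · subst hja
    by_cases hib : i = b
    · subst hib
      simp [hia]
    simp only [hia, hib, if_false, if_true]
    by_cases hid : i = d
    · subst hid
      have := hH e i hae.symm hbe.symm hia hib hde
      linarith
    · have h1 := hH d i had.symm hbd.symm hia hib hid
      have h2 := hX j b i d hab (Ne.symm hia) had (Ne.symm hib) hbd hid (by grind)
      linarith
  by_cases hib : i = b
  · subst hib
    simp only [hia, hja, if_false, if_true]
    by_cases hjd : j = d
    · subst hjd
      ring
    · have := hX a i j d hab (Ne.symm hja) had hij hbd hjd (by grind)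
      linarith
  · simp only [hia, hja, hib, if_false]
    by_cases hjb : j = b
    · subst hjb
      ring
    · have := hX i a j b hia hij hib (Ne.symm hja) hab hjb (by grind)
      linarith

end Separable

section CardinalityForcing

variable {n : ℕ}

/-- The cardinality forcing functional, with `p` and `q` the consecutive cardinalities. -/
noncomputable def forcingFunctional (W : Finset (Fin n)) (p q : ℕ) :
    (Fin n → Fin n → ℝ) →ₗ[ℝ] ℝ where
  toFun x := ((q : ℝ) - W.card) * (∑ i ∈ W, outSum x i)
    - ((W.card : ℝ) - p) * (∑ i ∈ Finset.univ \ W, outSum x i)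
  map_add' x y := by
    simp only [outSum, Pi.add_apply, sum_add_distrib]
    ring
  map_smul' r x := by
    simp only [outSum, Pi.smul_apply, smul_eq_mul, ← mul_sum, RingHom.id_apply]
    ring

/-- The functional `x ↦ x(δ^out(i))`. -/
noncomputable def outSumLin (i : Fin n) : (Fin n → Fin n → ℝ) →ₗ[ℝ] ℝ where
  toFun x := outSum x i
  map_add' x y := by simp only [outSum, Pi.add_apply, sum_add_distrib]
  map_smul' r x := by
    simp only [outSum, Pi.smul_apply, smul_eq_mul, ← mul_sum, RingHom.id_apply]

/-- The value of the cardinality forcing functional on a cycle with node set `V`. -/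
def forcingValue (W V : Finset (Fin n)) (p q : ℕ) : ℤ :=
  ((q : ℤ) - W.card) * (W ∩ V).card - ((W.card : ℤ) - p) * (V \ W).card

lemma forcingFunctional_incVec_cycleArcs (W : Finset (Fin n)) (p q : ℕ) {k : ℕ}
    {f : Fin (k + 2) → Fin n} (hf : Function.Injective f) :
    forcingFunctional W p q (incVec (cycleArcs f)) = forcingValue W (univ.image f) p q := by
  have hsd : (univ \ W) ∩ univ.image f = univ.image f \ W := by
    ext
    simp [and_comm]
  simp only [forcingFunctional, LinearMap.coe_mk, AddHom.coe_mk, outSum_incVec_cycleArcs hf,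
    sum_ite_mem, sum_const, nsmul_eq_mul, mul_one, hsd, forcingValue]
  push_cast
  ring

lemma forcingValue_of_subset {W V : Finset (Fin n)} {p q : ℕ} (hVW : V ⊆ W)
    (hV : V.card = p) : forcingValue W V p q = p * (q - W.card) := by
  rw [forcingValue, inter_eq_right.mpr hVW, sdiff_eq_empty_iff_subset.mpr hVW, hV]
  simp [mul_comm]

lemma forcingValue_of_superset {W V : Finset (Fin n)} {p q : ℕ} (hWV : W ⊆ V)
    (hV : V.card = q) : forcingValue W V p q = p * (q - W.card) := by
  have h : (V \ W).card + W.card = q := (card_sdiff_add_card_eq_card hWV).trans hV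
  rw [forcingValue, inter_eq_left.mpr hWV, ← h]
  push_cast
  ring

lemma forcingValue_le_or {W V : Finset (Fin n)} {p q : ℕ} (hpW : p < W.card)
    (hWq : W.card < q) (hV : V.card ≤ p ∨ q ≤ V.card) :
    (V ⊆ W ∧ V.card = p) ∨ (W ⊆ V ∧ V.card = q) ∨
      forcingValue W V p q + 1 ≤ p * (q - W.card) := by
  have hsum : (W ∩ V).card + (V \ W).card = V.card := by
    rw [inter_comm, card_inter_add_card_sdiff]
  have hle : (W ∩ V).card ≤ W.card := card_le_card inter_subset_left
  rcases hV with hV | hV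
  · by_cases ha : (W ∩ V).card = p
    · left
      have : (V \ W).card = 0 := by lia
      exact ⟨sdiff_eq_empty_iff_subset.mp (card_eq_zero.mp this), by lia⟩
    · right; right
      rw [forcingValue]
      obtain ⟨d, hd⟩ : ∃ d : ℕ, p = (W ∩ V).card + d + 1 := ⟨p - (W ∩ V).card - 1, by lia⟩
      obtain ⟨e, he⟩ : ∃ e : ℕ, W.card = p + e := ⟨W.card - p, by lia⟩
      obtain ⟨w, hw⟩ : ∃ w : ℕ, q = W.card + w + 1 := ⟨q - W.card - 1, by lia⟩
      have h1 : (0 : ℤ) ≤ (W.card - p) * (V \ W).card := by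
        rw [he]
        push_cast
        ring_nf
        positivity
      have h2 : (0 : ℤ) ≤ d * (w + 1) + w := by positivity
      rw [hw]
      push_cast
      have h3 : (p : ℤ) = (W ∩ V).card + d + 1 := by exact_mod_cast hd
      nlinarith
  · by_cases hd : (W ∩ V).card = W.card ∧ V.card = q
    · right; left
      exact ⟨inter_eq_left.mp (eq_of_subset_of_card_le inter_subset_left hd.1.ge), hd.2⟩
    · right; right
      rw [forcingValue]
      obtain ⟨d, hd'⟩ : ∃ d : ℕ, W.card = (W ∩ V).card + d := ⟨W.card - (W ∩ V).card, by lia⟩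
      obtain ⟨e, he⟩ : ∃ e : ℕ, V.card = q + e := ⟨V.card - q, by lia⟩
      have hde : 1 ≤ d + e := by lia
      have h1 : ((V \ W).card : ℤ) = q + e - W.card + d := by lia
      have h2 : ((W ∩ V).card : ℤ) = W.card - d := by lia
      rw [h1, h2]
      have h3 : (0 : ℤ) ≤ (q - W.card - 1) * d :=
        mul_nonneg (by lia) (by lia)
      have h4 : (0 : ℤ) ≤ (W.card - p - 1) * (d + e) :=
        mul_nonneg (by lia) (by lia)
      have h5 : (1 : ℤ) ≤ d + e := by exact_mod_cast hde
      nlinarith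

/-- Node weights that are constant on the tight cycles through `v₀` reproduce the cardinality
forcing functional up to a multiple of the degree functional of `v₀`. -/
lemma exists_weights_eq {W : Finset (Fin n)} {p q : ℕ} (hp : 2 ≤ p) (hpW : p < W.card)
    (hWq : W.card < q) (hqn : q ≤ n) (hcase : q < n ∨ W.card = n - 1) {v₀ : Fin n}
    (hv₀ : v₀ ∈ W) (θ : Fin n → ℝ) (γ : ℝ)
    (hθp : ∀ T ⊆ W, v₀ ∈ T → T.card = p → ∑ i ∈ T, θ i = γ)
    (hθq : ∀ S, W ⊆ S → S.card = q → ∑ i ∈ S, θ i = γ) :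
    ∃ μ ν : ℝ, ∀ V : Finset (Fin n),
      ∑ i ∈ V, θ i = μ * forcingValue W V p q + ν * if v₀ ∈ V then 1 else 0 := by
  have hin : ∀ i ∈ W, ∀ j ∈ W, i ≠ v₀ → j ≠ v₀ → θ i = θ j := by
    intro i hi j hj hi0 hj0
    rcases eq_or_ne i j with rfl | hij
    · rfl
    obtain ⟨R, hR1, hR2, hR3⟩ := exists_subsuperset_card_eq (s := {v₀}) (t := W \ {i, j})
      (n := p - 1) (by simp [hv₀, hi0.symm, hj0.symm]) (by simp; lia) (by
        rw [card_sdiff_of_subset (by simp [insert_subset_iff, hi, hj]), card_pair hij]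
        lia)
    have hRW : R ⊆ W := hR2.trans sdiff_subset
    have hiR : i ∉ R := fun h => by simpa using hR2 h
    have hjR : j ∉ R := fun h => by simpa using hR2 h
    have h0R : v₀ ∈ R := hR1 (mem_singleton_self _)
    have h1 := hθp (insert i R) (insert_subset hi hRW) (mem_insert_of_mem h0R)
      (by rw [card_insert_of_notMem hiR]; lia)
    have h2 := hθp (insert j R) (insert_subset hj hRW) (mem_insert_of_mem h0R)
      (by rw [card_insert_of_notMem hjR]; lia)
    rw [sum_insert hiR] at h1
    rw [sum_insert hjR] at h2
    linarith
  have hout : ∀ i ∉ W, ∀ j ∉ W, θ i = θ j := by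
    intro i hi j hj
    rcases eq_or_ne i j with rfl | hij
    · rfl
    have hsub : W ⊆ univ \ {i, j} := fun x hx => by
      simp only [mem_sdiff, mem_univ, mem_insert, mem_singleton, true_and, not_or]
      exact ⟨fun h => hi (h ▸ hx), fun h => hj (h ▸ hx)⟩
    have hcard : (univ \ {i, j} : Finset (Fin n)).card = n - 2 := by
      rw [card_sdiff_of_subset (subset_univ _), card_pair hij, card_univ, Fintype.card_fin]
    have hle := card_le_card hsub
    obtain ⟨R, hR1, hR2, hR3⟩ := exists_subsuperset_card_eq (n := q - 1) hsub
      (by lia) (by lia)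
    have hiR : i ∉ R := fun h => by simpa using hR2 h
    have hjR : j ∉ R := fun h => by simpa using hR2 h
    have h1 := hθq (insert i R) (hR1.trans (subset_insert _ _))
      (by rw [card_insert_of_notMem hiR]; lia)
    have h2 := hθq (insert j R) (hR1.trans (subset_insert _ _))
      (by rw [card_insert_of_notMem hjR]; lia)
    rw [sum_insert hiR] at h1
    rw [sum_insert hjR] at h2
    linarith
  obtain ⟨i₀, hi₀, hi₀v⟩ := exists_mem_ne (by lia : 1 < W.card) v₀
  obtain ⟨u₀, -, hu₀⟩ := exists_mem_notMem_of_card_lt_card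
    (by simpa using hWq.trans_le hqn : W.card < (univ : Finset (Fin n)).card)
  have hsum : ∀ V : Finset (Fin n), ∑ i ∈ V, θ i =
      θ i₀ * (W ∩ V).card + θ u₀ * (V \ W).card +
        (θ v₀ - θ i₀) * if v₀ ∈ V then 1 else 0 := by
    intro V
    have hθ : ∀ i, θ i = (if i ∈ W then θ i₀ else θ u₀) +
        if v₀ = i then θ v₀ - θ i₀ else 0 := by
      intro i
      by_cases hi0 : v₀ = i
      · subst hi0
        simp [hv₀]
      by_cases hiW : i ∈ W
      · simp [hi0, hiW, hin i hiW i₀ hi₀ (Ne.symm hi0) hi₀v]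
      · simp [hi0, hiW, hout i hiW u₀ hu₀]
    have h1 : V.filter (· ∈ W) = W ∩ V := by
      rw [filter_mem_eq_inter, inter_comm]
    have h2 : V.filter (· ∉ W) = V \ W := by
      ext
      simp
    rw [sum_congr rfl fun i _ => hθ i, sum_add_distrib, sum_ite_eq, sum_ite, h1, h2]
    simp [mul_comm]
  obtain ⟨T, hT1, hT2, hT3⟩ := exists_subsuperset_card_eq (s := {v₀}) (t := W) (n := p)
    (by simpa using hv₀) (by simp; lia) hpW.le
  obtain ⟨S, hS1, -, hS3⟩ := exists_subsuperset_card_eq (n := q) (subset_univ W) hWq.le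
    (by simpa using hqn)
  have h0T : v₀ ∈ T := hT1 (mem_singleton_self _)
  have hT := hθp T hT2 h0T hT3
  have hS := hθq S hS1 hS3
  have hcS : ((S \ W).card : ℝ) = q - W.card := by
    rw [card_sdiff_of_subset hS1, hS3, Nat.cast_sub hWq.le]
  rw [hsum, if_pos h0T, inter_eq_right.mpr hT2, sdiff_eq_empty_iff_subset.mpr hT2, hT3] at hT
  rw [hsum, if_pos (hS1 hv₀), inter_eq_left.mpr hS1, hcS] at hS
  simp only [card_empty, Nat.cast_zero, mul_zero, add_zero, mul_one] at hT hS
  have hqW : (0 : ℝ) < q - W.card := sub_pos.mpr (by exact_mod_cast hWq)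
  refine ⟨θ i₀ / (q - W.card), θ v₀ - θ i₀, fun V => ?_⟩
  have hκ : θ u₀ = - (θ i₀ / (q - W.card)) * (W.card - p) := by
    field_simp
    linarith
  rw [hsum, forcingValue, hκ]
  push_cast
  field_simp
  ring

end CardinalityForcing

section Facet

variable {n m : ℕ}

lemma incVec_cycleArcs_mem_cyclePolytope {c : Fin m → ℕ} {k : ℕ} {f : Fin (k + 2) → Fin n}
    (hf : Function.Injective f) {r : Fin m} (hr : (univ.image f).card = c r) :
    incVec (cycleArcs f) ∈ cyclePolytope n c :=
  subset_convexHull ℝ _ ⟨_, ⟨k, f, hf, rfl⟩, ⟨r, (card_cycleArcs hf).trans hr⟩, rfl⟩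

lemma incVec_cycleArcs_mem_Pstar {c : Fin m → ℕ} {k : ℕ} {f : Fin (k + 2) → Fin n}
    (hf : Function.Injective f) {r : Fin m} (hr : (univ.image f).card = c r) {v₀ : Fin n}
    (hv₀ : v₀ ∈ univ.image f) :
    incVec (cycleArcs f) ∈ {x ∈ cyclePolytope n c | outSum x v₀ = 1} :=
  ⟨incVec_cycleArcs_mem_cyclePolytope hf hr, by rw [outSum_incVec_cycleArcs hf, if_pos hv₀]⟩

/-- A linear inequality valid for all admissible cycles is valid for the polytope. -/
lemma le_of_mem_cyclePolytope {c : Fin m → ℕ} (φ : (Fin n → Fin n → ℝ) →ₗ[ℝ] ℝ) (b : ℝ)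
    (h : ∀ (k : ℕ) (f : Fin (k + 2) → Fin n), Function.Injective f → ∀ r,
      (univ.image f).card = c r → φ (incVec (cycleArcs f)) ≤ b)
    {x : Fin n → Fin n → ℝ} (hx : x ∈ cyclePolytope n c) : φ x ≤ b := by
  refine convexHull_min ?_ (convex_halfSpace_le φ.isLinear b) hx
  rintro _ ⟨_, ⟨k, f, hf, rfl⟩, ⟨r, hr⟩, rfl⟩
  exact h k f hf r ((card_cycleArcs hf).symm.trans hr)

/-- A functional that vanishes on tight cycles and is bounded by the slack elsewhere vanishes
on the face. -/
lemma eq_zero_of_mem_face {c : Fin m → ℕ} (φ g : (Fin n → Fin n → ℝ) →ₗ[ℝ] ℝ) (b : ℝ)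
    (h : ∀ (k : ℕ) (f : Fin (k + 2) → Fin n), Function.Injective f → ∀ r,
      (univ.image f).card = c r →
        |g (incVec (cycleArcs f))| ≤ b - φ (incVec (cycleArcs f)))
    {x : Fin n → Fin n → ℝ} (hx : x ∈ cyclePolytope n c) (hφ : φ x = b) : g x = 0 := by
  have h1 : (φ + g) x ≤ b := le_of_mem_cyclePolytope _ _ (fun k f hf r hr => by
    have := le_abs_self (g (incVec (cycleArcs f)))
    have := h k f hf r hr
    rw [LinearMap.add_apply]
    linarith) hx
  have h2 : (φ - g) x ≤ b := le_of_mem_cyclePolytope _ _ (fun k f hf r hr => by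
    have := neg_abs_le (g (incVec (cycleArcs f)))
    have := h k f hf r hr
    rw [LinearMap.sub_apply]
    linarith) hx
  rw [LinearMap.add_apply] at h1
  rw [LinearMap.sub_apply] at h2
  linarith

lemma exists_mul_add_of_const_on_tight {c : Fin m → ℕ} {W : Finset (Fin n)} {p q : ℕ}
    (hp : 2 ≤ p) (hpW : p < W.card) (hWq : W.card < q) (hqn : q ≤ n)
    (hcase : (W.card + 2 ≤ q ∧ q < n) ∨ (q = n ∧ W.card = n - 1)) {v₀ : Fin n}
    (hv₀ : v₀ ∈ W) (φ : (Fin n → Fin n → ℝ) →ₗ[ℝ] ℝ) (γ : ℝ)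
    (hφ : ∀ (k : ℕ) (f : Fin (k + 2) → Fin n), Function.Injective f → v₀ ∈ univ.image f →
      (univ.image f ⊆ W ∧ (univ.image f).card = p) ∨
        (W ⊆ univ.image f ∧ (univ.image f).card = q) →
      φ (incVec (cycleArcs f)) = γ) :
    ∃ μ ν : ℝ, ∀ x ∈ {x ∈ cyclePolytope n c | outSum x v₀ = 1},
      φ x = μ * forcingFunctional W p q x + ν := by
  have hcard : ∀ s : Finset (Fin n), s.card ≤ n := fun s => by simpa using s.card_le_univ
  obtain ⟨a, ha, b, hb, d, hd, hab, had, hbd⟩ := two_lt_card.mp (by lia : 2 < W.card)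
  obtain ⟨e, -, he⟩ := exists_mem_notMem_of_card_lt_card
    (by simpa using hWq.trans_le hqn : W.card < (univ : Finset (Fin n)).card)
  obtain ⟨α, β, hαβ⟩ := exists_separation_of_exchange (arcCoeff φ) hab had hbd
    (ne_of_mem_of_not_mem ha he) (ne_of_mem_of_not_mem hb he) (ne_of_mem_of_not_mem hd he) (by
      intro i j l t hij hil hit hjl hjt hlt hmem
      obtain ⟨S, hS1, -, hS3⟩ := exists_subsuperset_card_eq (n := q)
        (subset_univ (W ∪ {i, j, l, t})) (by
          rcases hcase with h | h
          · have h4 : ({i, j, l, t} : Finset (Fin n)).card = 4 := by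
              simp [card_insert_of_notMem, *]
            have h2 : (({i, j, l, t} : Finset (Fin n)) \ {a, b}).card = 2 := by
              rw [card_sdiff_of_subset hmem, h4, card_pair hab]
            have hsub : W ∪ {i, j, l, t} ⊆ W ∪ ({i, j, l, t} \ {a, b}) := by
              intro x hx
              simp only [mem_union, mem_sdiff] at hx ⊢
              by_cases hxab : x ∈ ({a, b} : Finset (Fin n))
              · left
                simp only [mem_insert, mem_singleton] at hxab
                rcases hxab with rfl | rfl <;> assumption
              · tauto
            have := (card_le_card hsub).trans (card_union_le _ _)
            lia
          · exact (hcard _).trans h.1.ge) (by simpa using hqn)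
      have hWS := union_subset_left hS1
      refine arcCoeff_exchange φ γ (S := S) (fun k f hf himg => ?_) hij hil hit hjl hjt hlt
        (union_subset_right hS1)
      subst himg
      exact hφ k f hf (hWS hv₀) (Or.inr ⟨hWS, hS3⟩))
  obtain ⟨μ, ν, hμν⟩ := exists_weights_eq hp hpW hWq hqn (by lia) hv₀
    (fun i => α i + β i) γ
    (fun T hTW h0 hT => by
      obtain ⟨k, f, hf, rfl⟩ := exists_cycle T (hT ▸ hp)
      rw [← map_incVec_cycleArcs_of_separable hf φ α β hαβ]
      exact hφ k f hf h0 (Or.inl ⟨hTW, hT⟩))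
    (fun S hWS hS => by
      obtain ⟨k, f, hf, rfl⟩ := exists_cycle S (by lia)
      rw [← map_incVec_cycleArcs_of_separable hf φ α β hαβ]
      exact hφ k f hf (hWS hv₀) (Or.inr ⟨hWS, hS⟩))
  refine ⟨μ, ν, fun x hx => ?_⟩
  have hzero := eq_zero_of_mem_face (c := c) 0
    (φ - μ • forcingFunctional W p q - ν • outSumLin v₀) 0 (fun k f hf r _ => by
      have h1 := map_incVec_cycleArcs_of_separable hf φ α β hαβ
      have h2 : outSumLin v₀ (incVec (cycleArcs f)) = if v₀ ∈ univ.image f then 1 else 0 :=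
        outSum_incVec_cycleArcs hf v₀
      rw [hμν, ← forcingFunctional_incVec_cycleArcs W p q hf, ← h2] at h1
      simp [h1]) hx.1 rfl
  have hout : outSumLin v₀ x = 1 := hx.2
  simp only [LinearMap.sub_apply, LinearMap.smul_apply, smul_eq_mul, hout] at hzero
  linarith

lemma forcingFunctional_le_or {c : Fin m → ℕ} (hmono : StrictMono c) {p q : Fin m}
    (hpq : (q : ℕ) = (p : ℕ) + 1) {W : Finset (Fin n)} (hW1 : c p < W.card)
    (hW2 : W.card < c q) {k : ℕ} {f : Fin (k + 2) → Fin n} (hf : Function.Injective f)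
    {r : Fin m} (hr : (univ.image f).card = c r) :
    (univ.image f ⊆ W ∧ (univ.image f).card = c p) ∨
      (W ⊆ univ.image f ∧ (univ.image f).card = c q) ∨
      forcingFunctional W (c p) (c q) (incVec (cycleArcs f)) + 1 ≤
        (c p : ℝ) * ((c q : ℝ) - W.card) := by
  rw [forcingFunctional_incVec_cycleArcs W _ _ hf]
  have hr' : (univ.image f).card ≤ c p ∨ c q ≤ (univ.image f).card := by
    rw [hr]
    rcases le_or_gt r p with h | h
    · exact Or.inl (hmono.monotone h)
    · exact Or.inr (hmono.monotone (by rw [Fin.le_def, hpq]; exact h))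
  rcases forcingValue_le_or hW1 hW2 hr' with h | h | h
  · exact Or.inl h
  · exact Or.inr (Or.inl h)
  · exact Or.inr (Or.inr (by exact_mod_cast h))

lemma forcingFunctional_eq_of_tight {W : Finset (Fin n)} {p q k : ℕ}
    {f : Fin (k + 2) → Fin n} (hf : Function.Injective f)
    (h : (univ.image f ⊆ W ∧ (univ.image f).card = p) ∨
      (W ⊆ univ.image f ∧ (univ.image f).card = q)) :
    forcingFunctional W p q (incVec (cycleArcs f)) = (p : ℝ) * ((q : ℝ) - W.card) := by
  rw [forcingFunctional_incVec_cycleArcs W _ _ hf]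
  rcases h with h | h
  · rw [forcingValue_of_subset h.1 h.2]
    push_cast
    rfl
  · rw [forcingValue_of_superset h.1 h.2]
    push_cast
    rfl

end Facet

/-- **Theorem 6 (cardinality forcing facets of `P*`).**  Let `D_n` be the complete
digraph on `n ≥ 4` nodes, `c` a cardinality sequence with `m ≥ 2` and
`2 ≤ c 0 < ⋯ < c (m-1) ≤ n`, and `W` a subset of the nodes containing the first node
`v₀` (the node "1") with `c p < |W| < c q` for consecutive indices `p, q`.  The
cardinality forcing inequality
`(c q − |W|)·Σ_{i∈W} x(δ^out(i)) − (|W| − c p)·Σ_{i∉W} x(δ^out(i)) ≤ c p·(c q − |W|)`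
defines a facet of `P* = {x ∈ P_C^c(D_n) : x(δ^out(v₀)) = 1}` if and only if
(`c q − |W| ≥ 2` and `c q < n`) or (`c q = n` and `|W| = n − 1`). -/
theorem cardinality_forcing_facet_Pstar (n m : ℕ) (hn : 4 ≤ n) (hm : 2 ≤ m)
    (c : Fin m → ℕ) (hmono : StrictMono c)
    (hc2 : ∀ p, 2 ≤ c p) (hcn : ∀ p, c p ≤ n)
    (v₀ : Fin n) (hv₀ : (v₀ : ℕ) = 0)
    (W : Finset (Fin n)) (hv₀W : v₀ ∈ W)
    (p q : Fin m) (hpq : (q : ℕ) = (p : ℕ) + 1)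
    (hW1 : c p < W.card) (hW2 : W.card < c q) :
    IsFacetLE {x ∈ cyclePolytope n c | outSum x v₀ = 1}
        (fun x => ((c q : ℝ) - W.card) * (∑ i ∈ W, outSum x i)
          - ((W.card : ℝ) - c p) * (∑ i ∈ Finset.univ \ W, outSum x i))
        ((c p : ℝ) * ((c q : ℝ) - W.card)) ↔
      (W.card + 2 ≤ c q ∧ c q < n) ∨ (c q = n ∧ W.card = n - 1) := by
  have hp2 := hc2 p
  have hqn := hcn q
  set P := {x ∈ cyclePolytope n c | outSum x v₀ = 1}
  set φ := forcingFunctional W (c p) (c q) with hφdef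
  set b := (c p : ℝ) * ((c q : ℝ) - W.card) with hb
  change ((∀ x ∈ P, φ x ≤ b) ∧ adim {x ∈ P | φ x = b} + 1 = adim P) ↔ _
  have hvalid : ∀ x ∈ P, φ x ≤ b := fun x hx =>
    le_of_mem_cyclePolytope φ b (fun k f hf r hr => by
      rcases forcingFunctional_le_or hmono hpq hW1 hW2 hf hr with h | h | h
      · exact (forcingFunctional_eq_of_tight hf (Or.inl h)).le
      · exact (forcingFunctional_eq_of_tight hf (Or.inr h)).le
      · linarith) hx.1
  have htight : ∀ (k : ℕ) (f : Fin (k + 2) → Fin n), Function.Injective f →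
      v₀ ∈ univ.image f → (univ.image f ⊆ W ∧ (univ.image f).card = c p) ∨
        (W ⊆ univ.image f ∧ (univ.image f).card = c q) →
      incVec (cycleArcs f) ∈ {x ∈ P | φ x = b} := by
    intro k f hf h0 h
    refine ⟨?_, forcingFunctional_eq_of_tight hf h⟩
    rcases h with h | h
    · exact incVec_cycleArcs_mem_Pstar hf h.2 h0
    · exact incVec_cycleArcs_mem_Pstar hf h.2 h0
  have hslack : ∀ (k : ℕ) (f : Fin (k + 2) → Fin n), Function.Injective f → ∀ r,
      (univ.image f).card = c r → ∀ u ∈ univ.image f, u ∉ W →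
      ¬ (W ⊆ univ.image f ∧ (univ.image f).card = c q) →
      φ (incVec (cycleArcs f)) < b := by
    intro k f hf r hr u hu huW hnq
    rcases forcingFunctional_le_or hmono hpq hW1 hW2 hf hr with h | h | h
    · exact absurd (h.1 hu) huW
    · exact absurd h hnq
    · linarith
  obtain ⟨T, hT1, hTW, hT⟩ := exists_subsuperset_card_eq (s := {v₀}) (t := W) (n := c p)
    (by simpa using hv₀W) (by simp; lia) hW1.le
  obtain ⟨k₀, f₀, hf₀, rfl⟩ := exists_cycle T (hT ▸ hp2)
  have hx₀ := htight k₀ f₀ hf₀ (hT1 (mem_singleton_self _)) (Or.inl ⟨hTW, hT⟩)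
  have hcycle : ∀ u ∉ W, ∀ w ∉ W, u ≠ w → ∃ (k : ℕ) (f : Fin (k + 2) → Fin n),
      Function.Injective f ∧ (univ.image f).card = c p ∧ v₀ ∈ univ.image f ∧
        u ∈ univ.image f ∧ w ∉ univ.image f := by
    intro u hu w hw huw
    have hvu : v₀ ≠ u := fun h => hu (h ▸ hv₀W)
    have hvw : v₀ ≠ w := fun h => hw (h ▸ hv₀W)
    obtain ⟨V, hV1, hV2, hV⟩ := exists_subsuperset_card_eq (s := {v₀, u})
      (t := univ.erase w) (n := c p) (by simp [insert_subset_iff, hvw, huw])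
      (by rwa [card_pair hvu]) (by simp; lia)
    obtain ⟨k, f, hf, rfl⟩ := exists_cycle V (hV ▸ hp2)
    simp only [insert_subset_iff, singleton_subset_iff] at hV1
    exact ⟨k, f, hf, hV, hV1.1, hV1.2, fun h => by simpa using hV2 h⟩
  constructor
  · rintro ⟨-, hdim⟩
    by_contra hcon
    have hWc : 1 < (univ \ W).card := by
      rw [card_sdiff_of_subset (subset_univ _), card_univ, Fintype.card_fin]
      lia
    obtain ⟨u, hu, w, hw, huw⟩ := one_lt_card.mp hWc
    replace hu : u ∉ W := (mem_sdiff.mp hu).2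
    replace hw : w ∉ W := (mem_sdiff.mp hw).2
    suffices adim {x ∈ P | φ x = b} + 2 ≤ adim P by lia
    by_cases hqn' : c q = n
    · obtain ⟨k₁, f₁, hf₁, hc₁, h0₁, hu₁, hw₁⟩ := hcycle u hu w hw huw
      obtain ⟨k₂, f₂, hf₂, hc₂, h0₂, hw₂, hu₂⟩ := hcycle w hw u hu huw.symm
      have h1 := hslack k₁ f₁ hf₁ p hc₁ u hu₁ hu (by lia)
      have h2 := hslack k₂ f₂ hf₂ p hc₂ w hw₂ hw (by lia)
      have hg : ∀ (k : ℕ) (f : Fin (k + 2) → Fin n), Function.Injective f →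
          (outSumLin u - outSumLin w) (incVec (cycleArcs f)) =
            (if u ∈ univ.image f then 1 else 0) - (if w ∈ univ.image f then 1 else 0) :=
        fun k f hf => congrArg₂ (· - ·) (outSum_incVec_cycleArcs hf u)
          (outSum_incVec_cycleArcs hf w)
      refine adim_add_two_le (Set.sep_subset _ _) φ (outSumLin u - outSumLin w) b 0
        (fun x hx => hx.2) (fun x hx => ?_) hx₀ (incVec_cycleArcs_mem_Pstar hf₁ hc₁ h0₁)
        (incVec_cycleArcs_mem_Pstar hf₂ hc₂ h0₂) h1.ne ?_
      · refine eq_zero_of_mem_face φ _ b (fun k f hf r hr => ?_) hx.1.1 hx.2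
        rw [hg k f hf]
        rcases forcingFunctional_le_or hmono hpq hW1 hW2 hf hr with h | h | h
        · rw [if_neg fun hh => hu (h.1 hh), if_neg fun hh => hw (h.1 hh),
            hφdef, forcingFunctional_eq_of_tight hf (Or.inl h)]
          simp [hb]
        · have huniv : univ.image f = univ := by
            rw [← card_eq_iff_eq_univ, Fintype.card_fin, h.2, hqn']
          rw [hφdef, forcingFunctional_eq_of_tight hf (Or.inr h), huniv]
          simp [hb]
        · refine le_trans ?_ (by linarith : (1 : ℝ) ≤ _)
          split_ifs <;> simp
      · rw [hg _ _ hf₁, hg _ _ hf₂, if_pos hu₁, if_neg hw₁, if_neg hu₂, if_pos hw₂]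
        intro h
        linarith
    · have hqW : c q = W.card + 1 := by lia
      have hvu : v₀ ≠ u := fun h => hu (h ▸ hv₀W)
      have hvw : v₀ ≠ w := fun h => hw (h ▸ hv₀W)
      obtain ⟨t, htW, htv⟩ := exists_mem_ne (by lia : 1 < W.card) v₀
      have hut : u ≠ t := fun h => hu (h ▸ htW)
      have hwt : w ≠ t := fun h => hw (h ▸ htW)
      obtain ⟨S, hS1, -, hS⟩ := exists_subsuperset_card_eq (n := c q)
        (subset_univ {u, w, v₀, t}) (card_le_four.trans (by lia)) (by simpa using hqn)
      simp only [insert_subset_iff, singleton_subset_iff] at hS1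
      obtain ⟨hSu, hSw, hSv, hSt⟩ := hS1
      obtain ⟨k₁, f₁, hf₁, hc₁, hu₁, hw₁, -, -⟩ :=
        exists_cycle_with_start huw hvu.symm hut hvw.symm hwt htv.symm hSu hSw hSv hSt
      obtain ⟨k₂, f₂, hf₂, hc₂, hu₂, hv₂, -, -⟩ :=
        exists_cycle_with_start hvu.symm huw hut hvw htv.symm hwt hSu hSv hSw hSt
      have hnot : ∀ V : Finset (Fin n), u ∈ V → w ∈ V → ¬ (W ⊆ V ∧ V.card = c q) := by
        rintro V huV hwV ⟨hWV, hV⟩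
        have hsub : insert u (insert w W) ⊆ V :=
          insert_subset huV (insert_subset hwV hWV)
        have := card_le_card hsub
        rw [card_insert_of_notMem (by simp [huw, hu]), card_insert_of_notMem hw] at this
        lia
      have h1 := hslack (k₁ + 2) f₁ hf₁ q (hc₁ ▸ hS) u (hc₁ ▸ hSu) hu
        (hnot _ (hc₁ ▸ hSu) (hc₁ ▸ hSw))
      have h2 := hslack (k₂ + 2) f₂ hf₂ q (hc₂ ▸ hS) u (hc₂ ▸ hSu) hu
        (hnot _ (hc₂ ▸ hSu) (hc₂ ▸ hSw))
      let g : (Fin n → Fin n → ℝ) →ₗ[ℝ] ℝ := LinearMap.proj w ∘ₗ LinearMap.proj u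
      have hg : ∀ C : Finset (Fin n × Fin n), g (incVec C) = if (u, w) ∈ C then 1 else 0 :=
        fun C => rfl
      refine adim_add_two_le (Set.sep_subset _ _) φ g b 0
        (fun x hx => hx.2) (fun x hx => ?_) hx₀
        (incVec_cycleArcs_mem_Pstar hf₂ (hc₂ ▸ hS) (hc₂ ▸ hSv))
        (incVec_cycleArcs_mem_Pstar hf₁ (hc₁ ▸ hS) (hc₁ ▸ hSv)) h2.ne ?_
      · refine eq_zero_of_mem_face φ _ b (fun k f hf r hr => ?_) hx.1.1 hx.2
        rw [hg]
        rcases forcingFunctional_le_or hmono hpq hW1 hW2 hf hr with h | h | h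
        · rw [if_neg fun hh => hu (h.1 (mem_image_of_mem_cycleArcs hh).1),
            hφdef, forcingFunctional_eq_of_tight hf (Or.inl h)]
          simp [hb]
        · rw [if_neg fun hh => hnot _ (mem_image_of_mem_cycleArcs hh).1
              (mem_image_of_mem_cycleArcs hh).2 h,
            hφdef, forcingFunctional_eq_of_tight hf (Or.inr h)]
          simp [hb]
        · refine le_trans ?_ (by linarith : (1 : ℝ) ≤ _)
          split_ifs <;> simp
      · have hm₁ : (u, w) ∈ cycleArcs f₁ := by
          rw [← hu₁]
          exact (mem_cycleArcs hf₁ _ _).mpr hw₁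
        have hm₂ : (u, w) ∉ cycleArcs f₂ := by
          rw [← hu₂]
          exact fun h => hvw (hv₂.symm.trans ((mem_cycleArcs hf₂ _ _).mp h))
        rw [hg, hg, if_pos hm₁, if_neg hm₂]
        intro h
        linarith
  · intro hcase
    refine ⟨hvalid, ?_⟩
    obtain ⟨u, -, hu⟩ := exists_mem_notMem_of_card_lt_card
      (by simpa using hW2.trans_le hqn : W.card < (univ : Finset (Fin n)).card)
    have hvu : v₀ ≠ u := fun h => hu (h ▸ hv₀W)
    obtain ⟨V, hV1, -, hV⟩ := exists_subsuperset_card_eq (n := c p) (subset_univ {v₀, u})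
      (by rwa [card_pair hvu]) (by simpa using hcn p)
    obtain ⟨k₁, f₁, hf₁, rfl⟩ := exists_cycle V (hV ▸ hp2)
    simp only [insert_subset_iff, singleton_subset_iff] at hV1
    refine adim_add_one_eq_of_forall_dual (Set.sep_subset _ _) φ b (fun x hx => hx.2) hx₀
      (incVec_cycleArcs_mem_Pstar hf₁ hV hV1.1)
      (hslack k₁ f₁ hf₁ p hV u hV1.2 hu (by lia)).ne (fun ψ hψ => ?_)
    exact exists_mul_add_of_const_on_tight hp2 hW1 hW2 hqn hcase hv₀W ψ _
      (fun k f hf h0 h => hψ _ (htight k f hf h0 h) _ hx₀)
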